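/- For a two-dimensional complex Finsler metric on D, the following are equivalent: (a) ∂G^i/∂η̄^h = 0 on D for all i,h; (b) m̄^s·(∂O/∂η̄^s) = ½·B̄·O on D; (c) δ_k(Ā)·η^k + F·Ā·(J+Y) = 0 on D. -/

import Mathlib

open Complex

noncomputable section

namespace CFinsler

/-- A point of `T'M` in local coordinates: `(z, η) ∈ ℂⁿ × ℂⁿ`. -/
abbrev Pt (n : ℕ) := (Fin n → ℂ) × (Fin n → ℂ)

variable {n : ℕ}

/-- Wirtinger derivative `∂f/∂z^k`. -/
def dz (f : Pt n → ℂ) (k : Fin n) (p : Pt n) : ℂ :=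
  (1 / 2) * (fderiv ℝ f p ((Pi.single k 1 : Fin n → ℂ), 0) -
    Complex.I * fderiv ℝ f p ((Pi.single k Complex.I : Fin n → ℂ), 0))

/-- Wirtinger derivative `∂f/∂z̄^k`. -/
def dzbar (f : Pt n → ℂ) (k : Fin n) (p : Pt n) : ℂ :=
  (1 / 2) * (fderiv ℝ f p ((Pi.single k 1 : Fin n → ℂ), 0) +
    Complex.I * fderiv ℝ f p ((Pi.single k Complex.I : Fin n → ℂ), 0))

/-- Wirtinger derivative `∂f/∂η^k`. -/
def de (f : Pt n → ℂ) (k : Fin n) (p : Pt n) : ℂ :=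
  (1 / 2) * (fderiv ℝ f p (0, (Pi.single k 1 : Fin n → ℂ)) -
    Complex.I * fderiv ℝ f p (0, (Pi.single k Complex.I : Fin n → ℂ)))

/-- Wirtinger derivative `∂f/∂η̄^k`. -/
def debar (f : Pt n → ℂ) (k : Fin n) (p : Pt n) : ℂ :=
  (1 / 2) * (fderiv ℝ f p (0, (Pi.single k 1 : Fin n → ℂ)) +
    Complex.I * fderiv ℝ f p (0, (Pi.single k Complex.I : Fin n → ℂ)))

/-- The fundamental metric tensor `g_{i j̄} := ∂²L/∂η^i ∂η̄^j`. -/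
def gm (L : Pt n → ℂ) (i j : Fin n) : Pt n → ℂ := de (debar L j) i

/-- `L` is an `n`-dimensional complex Finsler metric on `D`. -/
structure IsCFM (n : ℕ) (D : Set (Pt n)) (L : Pt n → ℂ) : Prop where
  openD : IsOpen D
  fiber_ne : ∀ p ∈ D, p.2 ≠ 0
  conic : ∀ p ∈ D, ∀ lam : ℂ, lam ≠ 0 → (p.1, lam • p.2) ∈ D
  smooth : ContDiffOn ℝ (⊤ : ℕ∞) L D
  real_im : ∀ p ∈ D, (L p).im = 0
  pos : ∀ p ∈ D, 0 < (L p).re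
  homog : ∀ p ∈ D, ∀ lam : ℂ, lam ≠ 0 →
    L (p.1, lam • p.2) = ((Complex.normSq lam : ℝ) : ℂ) * L p
  hermitian : ∀ p ∈ D, ∀ i j, (starRingEnd ℂ) (gm L i j p) = gm L j i p
  posdef : ∀ p ∈ D, ∀ v : Fin n → ℂ, v ≠ 0 →
    0 < (∑ i, ∑ j, gm L i j p * v i * (starRingEnd ℂ) (v j)).re

variable (L : Pt n → ℂ)

/-- The metric tensor as a matrix at a point. -/
def gmat (p : Pt n) : Matrix (Fin n) (Fin n) ℂ := fun i j => gm L i j p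

/-- The inverse metric tensor `g^{l̄ i}`. -/
def gi (l i : Fin n) (p : Pt n) : ℂ := (gmat L p)⁻¹ l i

/-- The Chern–Finsler nonlinear connection coefficients
`N^i_k := g^{m̄ i} (∂g_{l m̄}/∂z^k) η^l`. -/
def Nc (i k : Fin n) (p : Pt n) : ℂ :=
  ∑ m, ∑ l, gi L m i p * dz (gm L l m) k p * p.2 l

/-- The horizontal derivation `δ_k := ∂/∂z^k − N^j_k ∂/∂η^j`. -/
def del (f : Pt n → ℂ) (k : Fin n) (p : Pt n) : ℂ :=
  dz f k p - ∑ j, Nc L j k p * de f j p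

/-- The conjugate horizontal derivation `δ_k̄ := ∂/∂z̄^k − N̄^j_k ∂/∂η̄^j`. -/
def delbar (f : Pt n → ℂ) (k : Fin n) (p : Pt n) : ℂ :=
  dzbar f k p - ∑ j, (starRingEnd ℂ) (Nc L j k p) * debar f j p

/-- The horizontal Chern–Finsler connection coefficients `L^i_{jk} := g^{l̄ i} δ_k(g_{j l̄})`. -/
def Lc (i j k : Fin n) (p : Pt n) : ℂ := ∑ l, gi L l i p * del L (gm L j l) k p

/-- The vertical Chern–Finsler connection coefficients `C^i_{jk} := g^{l̄ i} ∂g_{j l̄}/∂η^k`. -/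
def Cc (i j k : Fin n) (p : Pt n) : ℂ := ∑ l, gi L l i p * de (gm L j l) k p

/-- The spray coefficients `G^i := ½ N^i_j η^j`. -/
def Gs (i : Fin n) (p : Pt n) : ℂ := (1 / 2) * ∑ j, Nc L i j p * p.2 j

/-- The canonical horizontal derivation `δ̊_k := ∂/∂z^k − (∂G^j/∂η^k) ∂/∂η^j`. -/
def delc (f : Pt n → ℂ) (k : Fin n) (p : Pt n) : ℂ :=
  dz f k p - ∑ j, de (Gs L j) k p * de f j p

/-- `F := √L`. -/
def Fh (p : Pt n) : ℂ := (Real.sqrt ((L p).re) : ℂ)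

/-- `l^i := η^i / F`. -/
def lup (i : Fin n) (p : Pt n) : ℂ := p.2 i / Fh L p

/-- `l_i := g_{i j̄} η̄^j / F`. -/
def llow (i : Fin n) (p : Pt n) : ℂ :=
  (∑ j, gm L i j p * (starRingEnd ℂ) (p.2 j)) / Fh L p

/-- `√g` where `g := det(g_{i j̄})`. -/
def sg (p : Pt n) : ℂ := (Real.sqrt ((gmat L p).det.re) : ℂ)

/-- The metric is Kähler. -/
def IsKahler (D : Set (Pt n)) : Prop := ∀ p ∈ D, ∀ i j k, Lc L i j k p = Lc L i k j p

/-- The metric is weakly Kähler. -/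
def IsWeaklyKahler (D : Set (Pt n)) : Prop :=
  ∀ p ∈ D, ∀ k, (∑ i, ∑ j, ∑ l, gm L i l p * (Lc L i j k p - Lc L i k j p) *
    p.2 j * (starRingEnd ℂ) (p.2 l)) = 0

/-- The metric is purely Hermitian: `g_{i j̄}` does not depend on the fibre variable. -/
def IsPurelyHermitian (D : Set (Pt n)) : Prop :=
  ∀ p ∈ D, ∀ i j k, de (gm L i j) k p = 0 ∧ debar (gm L i j) k p = 0

/-- The metric is a complex Berwald metric: Kähler with `L^i_{jk}` independent of the
fibre variable. -/
def IsBerwald (D : Set (Pt n)) : Prop :=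
  IsKahler L D ∧ ∀ p ∈ D, ∀ i j k l, de (Lc L i j k) l p = 0 ∧ debar (Lc L i j k) l p = 0

/-- The metric is a complex Landsberg metric: the Berwald and Rund connections coincide. -/
def IsLandsberg (D : Set (Pt n)) : Prop :=
  ∀ p ∈ D, ∀ i j k, de (de (Gs L i) k) j p =
    (1 / 2) * ∑ l, gi L l i p * (delc L (gm L j l) k p + delc L (gm L k l) j p)

/-- `m^i` of the local complex Berwald frame: `m¹ = −l₂/√g`, `m² = l₁/√g`. -/
def mup (L : Pt 2 → ℂ) (i : Fin 2) (p : Pt 2) : ℂ :=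
  if i = 0 then -(llow L 1 p) / sg L p else llow L 0 p / sg L p

/-- `m_i := g_{i j̄} m̄^j`. -/
def mlow (L : Pt 2 → ℂ) (i : Fin 2) (p : Pt 2) : ℂ :=
  ∑ j, gm L i j p * (starRingEnd ℂ) (mup L j p)

/-- `A := m^j m^k l_h C^h_{kj}`. -/
def sA (L : Pt 2 → ℂ) (p : Pt 2) : ℂ :=
  ∑ j, ∑ k, ∑ h, mup L j p * mup L k p * llow L h p * Cc L h k j p

/-- `B := m_h m^k m^j C^h_{jk}`. -/
def sB (L : Pt 2 → ℂ) (p : Pt 2) : ℂ :=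
  ∑ j, ∑ k, ∑ h, mlow L h p * mup L k p * mup L j p * Cc L h j k p

/-- `J := l^j l^k l_i L^i_{jk}`. -/
def sJ (L : Pt 2 → ℂ) (p : Pt 2) : ℂ :=
  ∑ j, ∑ k, ∑ i, lup L j p * lup L k p * llow L i p * Lc L i j k p

/-- `U := m^j l^k l_i L^i_{jk}`. -/
def sU (L : Pt 2 → ℂ) (p : Pt 2) : ℂ :=
  ∑ j, ∑ k, ∑ i, mup L j p * lup L k p * llow L i p * Lc L i j k p

/-- `V := l^j m^k l_i L^i_{jk}`. -/
def sV (L : Pt 2 → ℂ) (p : Pt 2) : ℂ :=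
  ∑ j, ∑ k, ∑ i, lup L j p * mup L k p * llow L i p * Lc L i j k p

/-- `X := m^j m^k l_i L^i_{jk}`. -/
def sX (L : Pt 2 → ℂ) (p : Pt 2) : ℂ :=
  ∑ j, ∑ k, ∑ i, mup L j p * mup L k p * llow L i p * Lc L i j k p

/-- `O := l^j l^k m_i L^i_{jk}`. -/
def sO (L : Pt 2 → ℂ) (p : Pt 2) : ℂ :=
  ∑ j, ∑ k, ∑ i, lup L j p * lup L k p * mlow L i p * Lc L i j k p

/-- `Y := m^j l^k m_i L^i_{jk}`. -/
def sY (L : Pt 2 → ℂ) (p : Pt 2) : ℂ :=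
  ∑ j, ∑ k, ∑ i, mup L j p * lup L k p * mlow L i p * Lc L i j k p

/-- `E := l^j m^k m_i L^i_{jk}`. -/
def sE (L : Pt 2 → ℂ) (p : Pt 2) : ℂ :=
  ∑ j, ∑ k, ∑ i, lup L j p * mup L k p * mlow L i p * Lc L i j k p

/-- `H := m^j m^k m_i L^i_{jk}`. -/
def sH (L : Pt 2 → ℂ) (p : Pt 2) : ℂ :=
  ∑ j, ∑ k, ∑ i, mup L j p * mup L k p * mlow L i p * Lc L i j k p

/-- The vertical curvature invariant `I := −(∂B/∂η̄^s) m̄^s − B B̄/2`. -/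
def vI (L : Pt 2 → ℂ) (p : Pt 2) : ℂ :=
  -(∑ s, debar (sB L) s p * (starRingEnd ℂ) (mup L s p)) -
    sB L p * (starRingEnd ℂ) (sB L p) / 2

/-- The `v v̄`-Riemann type tensor `S_{r̄ j h̄ k} := −g_{i r̄} ∂C^i_{jk}/∂η̄^h`. -/
def Sv (L : Pt 2 → ℂ) (r j h k : Fin 2) (p : Pt 2) : ℂ :=
  -∑ i, gm L i r p * debar (Cc L i j k) h p

/-- The `h h̄`-Riemann type tensor
`R_{r̄ j h̄ k} := g_{i r̄} (−δ_h̄(L^i_{jk}) − δ_h̄(N^l_k) C^i_{jl})`. -/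
def Rh (L : Pt 2 → ℂ) (r j h k : Fin 2) (p : Pt 2) : ℂ :=
  ∑ i, gm L i r p *
    (-(delbar L (Lc L i j k) h p) - ∑ l, delbar L (Nc L l k) h p * Cc L i j l p)

/-- The horizontal curvature invariant `K := −(1/F) δ_k̄(J) η̄^k`. -/
def hK (L : Pt 2 → ℂ) (p : Pt 2) : ℂ :=
  -(1 / Fh L p) * ∑ k, delbar L (sJ L) k p * (starRingEnd ℂ) (p.2 k)

/-- The horizontal curvature invariant
`W := −δ_s̄(H) m̄^s − ½ H (V̄+H̄) − B F δ_s̄(E) m̄^s`. -/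
def hW (L : Pt 2 → ℂ) (p : Pt 2) : ℂ :=
  -(∑ s, delbar L (sH L) s p * (starRingEnd ℂ) (mup L s p)) -
    (1 / 2) * sH L p * ((starRingEnd ℂ) (sV L p) + (starRingEnd ℂ) (sH L p)) -
    sB L p * Fh L p * ∑ s, delbar L (sE L) s p * (starRingEnd ℂ) (mup L s p)

/-- The weak symmetry condition `R_{0̄ k 0̄ 0} = R_{0̄ 0 0̄ k}`, i.e.
`R_{r̄ k h̄ s} η̄^r η̄^h η^s = R_{r̄ s h̄ k} η̄^r η^s η̄^h`. -/
def WeakSym (L : Pt 2 → ℂ) (D : Set (Pt 2)) : Prop :=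
  ∀ p ∈ D, ∀ k,
    (∑ r, ∑ h, ∑ s, Rh L r k h s p * (starRingEnd ℂ) (p.2 r) *
      (starRingEnd ℂ) (p.2 h) * p.2 s) =
    ∑ r, ∑ s, ∑ h, Rh L r s h k p * (starRingEnd ℂ) (p.2 r) * p.2 s *
      (starRingEnd ℂ) (p.2 h)

/-- A derivation at `p` of the algebra of functions that are smooth on `D`. -/
structure IsDer (D : Set (Pt n)) (p : Pt n) (X : (Pt n → ℂ) → ℂ) : Prop where
  congr : ∀ f g : Pt n → ℂ, (∀ q ∈ D, f q = g q) → X f = X g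
  const : ∀ c : ℂ, X (fun _ => c) = 0
  add : ∀ f g : Pt n → ℂ, ContDiffOn ℝ (⊤ : ℕ∞) f D → ContDiffOn ℝ (⊤ : ℕ∞) g D →
    X (fun q => f q + g q) = X f + X g
  mul : ∀ f g : Pt n → ℂ, ContDiffOn ℝ (⊤ : ℕ∞) f D → ContDiffOn ℝ (⊤ : ℕ∞) g D →
    X (fun q => f q * g q) = X f * g p + f p * X g

namespace IsDer

variable {D : Set (Pt n)} {p : Pt n} {X Y : (Pt n → ℂ) → ℂ} {f g : Pt n → ℂ}

theorem sub (hX : IsDer D p X) (hf : ContDiffOn ℝ (⊤ : ℕ∞) f D)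
    (hg : ContDiffOn ℝ (⊤ : ℕ∞) g D) : X (fun q => f q - g q) = X f - X g := by
  have h := hX.add (fun q => f q - g q) g (hf.sub hg) hg
  simp only [sub_add_cancel] at h
  exact eq_sub_of_add_eq h.symm

theorem mul_const (hX : IsDer D p X) (c : ℂ) (hf : ContDiffOn ℝ (⊤ : ℕ∞) f D) :
    X (fun q => c * f q) = c * X f := by
  rw [hX.mul (fun _ => c) f contDiffOn_const hf, hX.const, zero_mul, zero_add]

theorem add_mul (hX : IsDer D p X) {a b c d : Pt n → ℂ} (ha : ContDiffOn ℝ (⊤ : ℕ∞) a D)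
    (hb : ContDiffOn ℝ (⊤ : ℕ∞) b D) (hc : ContDiffOn ℝ (⊤ : ℕ∞) c D)
    (hd : ContDiffOn ℝ (⊤ : ℕ∞) d D) :
    X (fun q => a q * b q + c q * d q) =
      X a * b p + a p * X b + (X c * d p + c p * X d) := by
  rw [hX.add (fun q => a q * b q) (fun q => c q * d q) (ha.mul hb) (hc.mul hd),
    hX.mul a b ha hb, hX.mul c d hc hd]

theorem linear_comb (hX : IsDer D p X) (hY : IsDer D p Y) (a b : ℂ) :
    IsDer D p (fun f => a * X f + b * Y f) where
  congr f g h := by simp only [hX.congr f g h, hY.congr f g h]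
  const c := by simp only [hX.const, hY.const]; ring
  add f g hf hg := by simp only [hX.add f g hf hg, hY.add f g hf hg]; ring
  mul f g hf hg := by simp only [hX.mul f g hf hg, hY.mul f g hf hg]; ring

end IsDer

/-- The common form of the four Wirtinger derivatives. -/
def wirt (c : ℂ) (v w : Pt n) (f : Pt n → ℂ) (p : Pt n) : ℂ :=
  (1 / 2) * (fderiv ℝ f p v + c * fderiv ℝ f p w)

section wirt

variable {D : Set (Pt n)} {p : Pt n} {f : Pt n → ℂ}

theorem differentiableAt_of_smooth (hD : IsOpen D) (hp : p ∈ D)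
    (hf : ContDiffOn ℝ (⊤ : ℕ∞) f D) : DifferentiableAt ℝ f p :=
  (hf.contDiffAt (hD.mem_nhds hp)).differentiableAt (by simp)

theorem isDer_wirt (hD : IsOpen D) (hp : p ∈ D) (c : ℂ) (v w : Pt n) :
    IsDer D p (fun f => wirt c v w f p) where
  congr f g h := by
    have : f =ᶠ[nhds p] g := by
      filter_upwards [hD.mem_nhds hp] with q hq using h q hq
    simp only [wirt, this.fderiv_eq]
  const a := by simp [wirt]
  add f g hf hg := by
    have := fderiv_fun_add (differentiableAt_of_smooth hD hp hf)
      (differentiableAt_of_smooth hD hp hg)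
    simp only [wirt, this, add_apply]
    ring
  mul f g hf hg := by
    have := fderiv_fun_mul (differentiableAt_of_smooth hD hp hf)
      (differentiableAt_of_smooth hD hp hg)
    simp only [wirt, this, add_apply, smul_apply,
      smul_eq_mul]
    ring

theorem contDiffOn_fderiv_apply (hD : IsOpen D) (hf : ContDiffOn ℝ (⊤ : ℕ∞) f D) (v : Pt n) :
    ContDiffOn ℝ (⊤ : ℕ∞) (fun q => fderiv ℝ f q v) D :=
  (hf.fderiv_of_isOpen hD (m := ((⊤ : ℕ∞) : WithTop ℕ∞)) (by simp)).clm_apply contDiffOn_const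

theorem contDiffOn_wirt (hD : IsOpen D) (hf : ContDiffOn ℝ (⊤ : ℕ∞) f D) (c : ℂ) (v w : Pt n) :
    ContDiffOn ℝ (⊤ : ℕ∞) (wirt c v w f) D :=
  contDiffOn_const.mul ((contDiffOn_fderiv_apply hD hf v).add
    (contDiffOn_const.mul (contDiffOn_fderiv_apply hD hf w)))

theorem fderiv_fderiv_comm (hD : IsOpen D) (hp : p ∈ D) (hf : ContDiffOn ℝ (⊤ : ℕ∞) f D)
    (v w : Pt n) :
    fderiv ℝ (fun q => fderiv ℝ f q v) p w = fderiv ℝ (fun q => fderiv ℝ f q w) p v := by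
  have hd : DifferentiableAt ℝ (fderiv ℝ f) p :=
    ((hf.fderiv_of_isOpen hD (m := ((⊤ : ℕ∞) : WithTop ℕ∞)) (by simp)).contDiffAt
      (hD.mem_nhds hp)).differentiableAt (by simp)
  have hs : IsSymmSndFDerivAt ℝ f p :=
    (hf.contDiffAt (hD.mem_nhds hp)).isSymmSndFDerivAt 
      (by simpa using WithTop.coe_le_coe.2 (le_top : (2 : ℕ∞) ≤ ⊤))
  have key : ∀ a : Pt n, fderiv ℝ (fun q => fderiv ℝ f q a) p =
      (fderiv ℝ (fderiv ℝ f) p).flip a := by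
    intro a
    rw [fderiv_clm_apply hd (differentiableAt_const a)]
    simp
  rw [key, key]
  exact hs w v

theorem fderiv_wirt (hD : IsOpen D) (hp : p ∈ D) (hf : ContDiffOn ℝ (⊤ : ℕ∞) f D)
    (c : ℂ) (v w u : Pt n) :
    fderiv ℝ (wirt c v w f) p u = (1 / 2) * (fderiv ℝ (fun q => fderiv ℝ f q v) p u +
      c * fderiv ℝ (fun q => fderiv ℝ f q w) p u) := by
  have h1 := differentiableAt_of_smooth hD hp (contDiffOn_fderiv_apply hD hf v)
  have h2 := differentiableAt_of_smooth hD hp (contDiffOn_fderiv_apply hD hf w)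
  have h := (h1.hasFDerivAt.fun_add (h2.hasFDerivAt.const_mul c)).const_mul (1 / 2 : ℂ)
  have h' : fderiv ℝ (wirt c v w f) p = _ := h.fderiv
  rw [h']
  simp
  ring

theorem wirt_comm (hD : IsOpen D) (hp : p ∈ D) (hf : ContDiffOn ℝ (⊤ : ℕ∞) f D)
    (c c' : ℂ) (v w v' w' : Pt n) :
    wirt c v w (wirt c' v' w' f) p = wirt c' v' w' (wirt c v w f) p := by
  rw [wirt, wirt, fderiv_wirt hD hp hf, fderiv_wirt hD hp hf, fderiv_wirt hD hp hf,
    fderiv_wirt hD hp hf, fderiv_fderiv_comm hD hp hf v v', fderiv_fderiv_comm hD hp hf v w',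
    fderiv_fderiv_comm hD hp hf w v', fderiv_fderiv_comm hD hp hf w w']
  ring

theorem dz_eq_wirt (f : Pt n → ℂ) (k : Fin n) : dz f k =
    wirt (-I) ((Pi.single k 1 : Fin n → ℂ), 0) ((Pi.single k I : Fin n → ℂ), 0) f := by
  funext q; simp only [dz, wirt]; ring

theorem de_eq_wirt (f : Pt n → ℂ) (k : Fin n) : de f k =
    wirt (-I) (0, (Pi.single k 1 : Fin n → ℂ)) (0, (Pi.single k I : Fin n → ℂ)) f := by
  funext q; simp only [de, wirt]; ring

theorem debar_eq_wirt (f : Pt n → ℂ) (k : Fin n) : debar f k =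
    wirt I (0, (Pi.single k 1 : Fin n → ℂ)) (0, (Pi.single k I : Fin n → ℂ)) f := rfl

theorem isDer_dz (hD : IsOpen D) (hp : p ∈ D) (k : Fin n) :
    IsDer D p (fun f => dz f k p) := by
  simp only [dz_eq_wirt]; exact isDer_wirt hD hp _ _ _

theorem isDer_de (hD : IsOpen D) (hp : p ∈ D) (k : Fin n) :
    IsDer D p (fun f => de f k p) := by
  simp only [de_eq_wirt]; exact isDer_wirt hD hp _ _ _

theorem isDer_debar (hD : IsOpen D) (hp : p ∈ D) (k : Fin n) :
    IsDer D p (fun f => debar f k p) := by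
  simp only [debar_eq_wirt]; exact isDer_wirt hD hp _ _ _

theorem contDiffOn_dz (hD : IsOpen D) (hf : ContDiffOn ℝ (⊤ : ℕ∞) f D) (k : Fin n) :
    ContDiffOn ℝ (⊤ : ℕ∞) (dz f k) D := by
  rw [dz_eq_wirt]; exact contDiffOn_wirt hD hf _ _ _

theorem contDiffOn_de (hD : IsOpen D) (hf : ContDiffOn ℝ (⊤ : ℕ∞) f D) (k : Fin n) :
    ContDiffOn ℝ (⊤ : ℕ∞) (de f k) D := by
  rw [de_eq_wirt]; exact contDiffOn_wirt hD hf _ _ _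

theorem contDiffOn_debar (hD : IsOpen D) (hf : ContDiffOn ℝ (⊤ : ℕ∞) f D) (k : Fin n) :
    ContDiffOn ℝ (⊤ : ℕ∞) (debar f k) D := by
  rw [debar_eq_wirt]; exact contDiffOn_wirt hD hf _ _ _

theorem debar_de_comm (hD : IsOpen D) (hp : p ∈ D) (hf : ContDiffOn ℝ (⊤ : ℕ∞) f D)
    (j k : Fin n) : debar (de f j) k p = de (debar f k) j p := by
  simp only [debar_eq_wirt, de_eq_wirt]; exact wirt_comm hD hp hf _ _ _ _ _ _

theorem debar_debar_comm (hD : IsOpen D) (hp : p ∈ D) (hf : ContDiffOn ℝ (⊤ : ℕ∞) f D)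
    (j k : Fin n) : debar (debar f j) k p = debar (debar f k) j p := by
  simp only [debar_eq_wirt]; exact wirt_comm hD hp hf _ _ _ _ _ _

theorem debar_dz_comm (hD : IsOpen D) (hp : p ∈ D) (hf : ContDiffOn ℝ (⊤ : ℕ∞) f D)
    (j k : Fin n) : debar (dz f j) k p = dz (debar f k) j p := by
  simp only [debar_eq_wirt, dz_eq_wirt]; exact wirt_comm hD hp hf _ _ _ _ _ _

theorem conj_de (f : Pt n → ℂ) (k : Fin n) (p : Pt n) :
    (starRingEnd ℂ) (de f k p) = debar (fun q => (starRingEnd ℂ) (f q)) k p := by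
  have h : fderiv ℝ (fun q => (starRingEnd ℂ) (f q)) p =
      (conjCLE : ℂ →L[ℝ] ℂ).comp (fderiv ℝ f p) := conjCLE.comp_fderiv
  simp only [de, debar, h, map_mul, map_sub, conj_I, map_div₀, map_one, map_ofNat]
  simp

end wirt

section coordinates

/-- The fibre coordinate `η^j`. -/
def eta (j : Fin n) (q : Pt n) : ℂ := q.2 j

/-- The conjugate fibre coordinate `η̄^j`. -/
def etab (j : Fin n) (q : Pt n) : ℂ := (starRingEnd ℂ) (q.2 j)

/-- The fibre coordinate `η^j` as a continuous linear map. -/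
def etaL (j : Fin n) : Pt n →L[ℝ] ℂ :=
  (ContinuousLinearMap.proj (R := ℝ) (φ := fun _ : Fin n => ℂ) j).comp
    (ContinuousLinearMap.snd ℝ (Fin n → ℂ) (Fin n → ℂ))

theorem fderiv_eta (j : Fin n) (p v : Pt n) : fderiv ℝ (eta j) p v = v.2 j := by
  have : fderiv ℝ (eta j) p = etaL j := (etaL j).fderiv
  rw [this]; rfl

theorem fderiv_etab (j : Fin n) (p v : Pt n) :
    fderiv ℝ (etab j) p v = (starRingEnd ℂ) (v.2 j) := by
  have : fderiv ℝ (etab j) p = (conjCLE : ℂ →L[ℝ] ℂ).comp (etaL j) :=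
    ((conjCLE : ℂ →L[ℝ] ℂ).comp (etaL j)).fderiv
  rw [this]; rfl

theorem contDiffOn_eta (D : Set (Pt n)) (j : Fin n) : ContDiffOn ℝ (⊤ : ℕ∞) (eta j) D :=
  (etaL j).contDiff.contDiffOn

theorem contDiffOn_etab (D : Set (Pt n)) (j : Fin n) : ContDiffOn ℝ (⊤ : ℕ∞) (etab j) D :=
  ((conjCLE : ℂ →L[ℝ] ℂ).comp (etaL j)).contDiff.contDiffOn

theorem dz_eta (j k : Fin n) (p : Pt n) : dz (eta j) k p = 0 := by simp [dz, fderiv_eta]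

theorem dz_etab (j k : Fin n) (p : Pt n) : dz (etab j) k p = 0 := by simp [dz, fderiv_etab]

theorem de_eta (j k : Fin n) (p : Pt n) : de (eta j) k p = if j = k then 1 else 0 := by
  rcases eq_or_ne j k with rfl | h
  · simp [de, fderiv_eta]; norm_num
  · simp [de, fderiv_eta, h]

theorem debar_eta (j k : Fin n) (p : Pt n) : debar (eta j) k p = 0 := by
  rcases eq_or_ne j k with rfl | h
  · simp [debar, fderiv_eta]
  · simp [debar, fderiv_eta, h]

theorem de_etab (j k : Fin n) (p : Pt n) : de (etab j) k p = 0 := by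
  rcases eq_or_ne j k with rfl | h
  · simp [de, fderiv_etab]
  · simp [de, fderiv_etab, h]

theorem debar_etab (j k : Fin n) (p : Pt n) : debar (etab j) k p = if j = k then 1 else 0 := by
  rcases eq_or_ne j k with rfl | h
  · simp [debar, fderiv_etab]; norm_num
  · simp [debar, fderiv_etab, h]

end coordinates

section metric

variable {D : Set (Pt 2)} {L : Pt 2 → ℂ} {p : Pt 2}

theorem fderiv_fibre (f : Pt 2 → ℂ) (p : Pt 2) (v : Fin 2 → ℂ) :
    fderiv ℝ f p (0, v) = (v 0).re * fderiv ℝ f p (0, (Pi.single 0 1 : Fin 2 → ℂ)) +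
      (v 0).im * fderiv ℝ f p (0, (Pi.single 0 I : Fin 2 → ℂ)) +
      (v 1).re * fderiv ℝ f p (0, (Pi.single 1 1 : Fin 2 → ℂ)) +
      (v 1).im * fderiv ℝ f p (0, (Pi.single 1 I : Fin 2 → ℂ)) := by
  have : ((0, v) : Pt 2) = (v 0).re • ((0, (Pi.single 0 1 : Fin 2 → ℂ)) : Pt 2) +
      (v 0).im • ((0, (Pi.single 0 I : Fin 2 → ℂ)) : Pt 2) +
      (v 1).re • ((0, (Pi.single 1 1 : Fin 2 → ℂ)) : Pt 2) +
      (v 1).im • ((0, (Pi.single 1 I : Fin 2 → ℂ)) : Pt 2) := by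
    refine Prod.ext ?_ ?_
    · simp
    · funext i
      fin_cases i <;> simp [Complex.re_add_im]
  rw [this]
  simp only [map_add, map_smul, real_smul]

namespace IsCFM

theorem contDiffOn_debar (hL : IsCFM 2 D L) (j : Fin 2) :
    ContDiffOn ℝ (⊤ : ℕ∞) (debar L j) D := CFinsler.contDiffOn_debar hL.openD hL.smooth j

theorem contDiffOn_gm (hL : IsCFM 2 D L) (i j : Fin 2) :
    ContDiffOn ℝ (⊤ : ℕ∞) (gm L i j) D :=
  CFinsler.contDiffOn_de hL.openD (hL.contDiffOn_debar j) i

theorem contDiffOn_debar_debar (hL : IsCFM 2 D L) (j h : Fin 2) :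
    ContDiffOn ℝ (⊤ : ℕ∞) (debar (debar L j) h) D :=
  CFinsler.contDiffOn_debar hL.openD (hL.contDiffOn_debar j) h

theorem fderiv_smul_fibre (hL : IsCFM 2 D L) (hp : p ∈ D) (c : ℂ) :
    fderiv ℝ L p (0, c • p.2) = 2 * c.re * L p := by
  have hγ : HasDerivAt (fun t : ℝ => p + t • ((0, c • p.2) : Pt 2)) (0, c • p.2) 0 := by
    simpa using ((hasDerivAt_id (0 : ℝ)).smul_const ((0, c • p.2) : Pt 2)).const_add p
  have hd : HasFDerivAt L (fderiv ℝ L p) (p + (0 : ℝ) • ((0, c • p.2) : Pt 2)) := by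
    simpa using (differentiableAt_of_smooth hL.openD hp hL.smooth).hasFDerivAt
  have h1 := hd.comp_hasDerivAt (0 : ℝ) hγ
  have h2 : HasDerivAt (fun t : ℝ => ((1 + 2 * c.re * t + normSq c * t ^ 2 : ℝ) : ℂ) * L p)
      (((2 * c.re : ℝ) : ℂ) * L p) 0 := by
    refine HasDerivAt.mul_const ?_ _
    refine HasDerivAt.ofReal_comp ?_
    have := (((hasDerivAt_id (0 : ℝ)).const_mul (2 * c.re)).const_add 1).fun_add
      (((hasDerivAt_id (0 : ℝ)).fun_pow 2).const_mul (normSq c))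
    simpa using this
  have h3 : (fun t : ℝ => ((1 + 2 * c.re * t + normSq c * t ^ 2 : ℝ) : ℂ) * L p) =ᶠ[nhds 0]
      (L ∘ fun t : ℝ => p + t • ((0, c • p.2) : Pt 2)) := by
    have hc : Continuous (fun t : ℝ => (1 : ℂ) + t * c) := by fun_prop
    have hne : ∀ᶠ t : ℝ in nhds 0, (1 : ℂ) + t * c ≠ 0 :=
      hc.continuousAt.eventually_ne (by simp)
    filter_upwards [hne] with t ht
    have e : p + t • ((0, c • p.2) : Pt 2) = (p.1, ((1 : ℂ) + t * c) • p.2) := by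
      refine Prod.ext (by simp) ?_
      funext i
      simp
      ring
    simp only [Function.comp, e, hL.homog p hp _ ht]
    congr 2
    simp [normSq_apply]
    ring
  have := (h1.congr_of_eventuallyEq h3).unique h2
  rw [this]
  push_cast
  ring

theorem euler_de (hL : IsCFM 2 D L) (hp : p ∈ D) :
    de L 0 p * eta 0 p + de L 1 p * eta 1 p = L p := by
  have h1 := hL.fderiv_smul_fibre hp 1
  have h2 := hL.fderiv_smul_fibre hp I
  rw [fderiv_fibre] at h1 h2
  simp at h1 h2
  simp only [de, eta]
  rw [← re_add_im (p.2 0), ← re_add_im (p.2 1)]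
  linear_combination (1 / 2) * h1 - (I / 2) * h2 - (1 / 2) * ((p.2 0).im *
    fderiv ℝ L p (0, (Pi.single 0 I : Fin 2 → ℂ)) + (p.2 1).im *
    fderiv ℝ L p (0, (Pi.single 1 I : Fin 2 → ℂ))) * I_sq

theorem conj_apply (hL : IsCFM 2 D L) (hp : p ∈ D) : (starRingEnd ℂ) (L p) = L p :=
  conj_eq_iff_im.2 (hL.real_im p hp)

theorem conj_de (hL : IsCFM 2 D L) (hp : p ∈ D) (j : Fin 2) :
    (starRingEnd ℂ) (de L j p) = debar L j p := by
  rw [CFinsler.conj_de]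
  exact (isDer_debar hL.openD hp j).congr _ _ fun q hq => hL.conj_apply hq

theorem euler_debar (hL : IsCFM 2 D L) (hp : p ∈ D) :
    debar L 0 p * etab 0 p + debar L 1 p * etab 1 p = L p := by
  have h := congrArg (starRingEnd ℂ) (hL.euler_de hp)
  simp only [map_add, map_mul, hL.conj_de hp, hL.conj_apply hp] at h
  exact h

theorem gm_etab (hL : IsCFM 2 D L) (hp : p ∈ D) (i : Fin 2) :
    gm L i 0 p * etab 0 p + gm L i 1 p * etab 1 p = de L i p := by
  have hX := isDer_de hL.openD hp i
  have h := hX.congr _ _ fun q hq => hL.euler_debar hq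
  rw [hX.add_mul (hL.contDiffOn_debar 0) (contDiffOn_etab D 0) (hL.contDiffOn_debar 1)
    (contDiffOn_etab D 1)] at h
  simp only [de_etab, mul_zero, add_zero] at h
  exact h

theorem gm_eta (hL : IsCFM 2 D L) (hp : p ∈ D) (j : Fin 2) :
    gm L 0 j p * eta 0 p + gm L 1 j p * eta 1 p = debar L j p := by
  have h := congrArg (starRingEnd ℂ) (hL.gm_etab hp j)
  simp only [map_add, map_mul, hL.conj_de hp, hL.hermitian p hp, etab, conj_conj] at h
  exact h

theorem debar_debar_etab (hL : IsCFM 2 D L) (hp : p ∈ D) (h : Fin 2) :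
    debar (debar L 0) h p * etab 0 p + debar (debar L 1) h p * etab 1 p = 0 := by
  have hX := isDer_debar hL.openD hp h
  have e := hX.congr _ _ fun q hq => hL.euler_debar hq
  rw [hX.add_mul (hL.contDiffOn_debar 0) (contDiffOn_etab D 0) (hL.contDiffOn_debar 1)
    (contDiffOn_etab D 1)] at e
  simp only [debar_etab] at e
  fin_cases h <;> simp at e ⊢ <;> linear_combination e

theorem debar_debar_symm (hL : IsCFM 2 D L) (hp : p ∈ D) (j h : Fin 2) :
    debar (debar L j) h p = debar (debar L h) j p :=
  debar_debar_comm hL.openD hp hL.smooth j h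

theorem debar_gm (hL : IsCFM 2 D L) (hp : p ∈ D) (i j h : Fin 2) :
    debar (gm L i j) h p = de (debar (debar L j) h) i p :=
  debar_de_comm hL.openD hp (hL.contDiffOn_debar j) i h

theorem debar_gm_etab (hL : IsCFM 2 D L) (hp : p ∈ D) (i h : Fin 2) :
    debar (gm L i 0) h p * etab 0 p + debar (gm L i 1) h p * etab 1 p = 0 := by
  have hX := isDer_de hL.openD hp i
  have e := hX.congr _ _ fun q hq => hL.debar_debar_etab hq h
  rw [hX.add_mul (hL.contDiffOn_debar_debar 0 h) (contDiffOn_etab D 0)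
    (hL.contDiffOn_debar_debar 1 h) (contDiffOn_etab D 1)] at e
  simpa only [de_etab, mul_zero, add_zero, hX.const, hL.debar_gm hp] using e

theorem debar_gm_eta (hL : IsCFM 2 D L) (hp : p ∈ D) (j h : Fin 2) :
    debar (gm L 0 j) h p * eta 0 p + debar (gm L 1 j) h p * eta 1 p =
      debar (debar L j) h p := by
  have hX := isDer_debar hL.openD hp h
  have e := hX.congr _ _ fun q hq => hL.gm_eta hq j
  rw [hX.add_mul (hL.contDiffOn_gm 0 j) (contDiffOn_eta D 0)
    (hL.contDiffOn_gm 1 j) (contDiffOn_eta D 1)] at e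
  simpa only [debar_eta, mul_zero, add_zero] using e

/-- The determinant of the metric tensor. -/
def gdet (L : Pt 2 → ℂ) (p : Pt 2) : ℂ := gm L 0 0 p * gm L 1 1 p - gm L 0 1 p * gm L 1 0 p

theorem det_gmat (L : Pt 2 → ℂ) (p : Pt 2) : (gmat L p).det = gdet L p := by
  rw [Matrix.det_fin_two]; rfl

theorem conj_gdet (hL : IsCFM 2 D L) (hp : p ∈ D) : (starRingEnd ℂ) (gdet L p) = gdet L p := by
  simp only [gdet, map_sub, map_mul, hL.hermitian p hp]
  ring

theorem gdet_re_pos (hL : IsCFM 2 D L) (hp : p ∈ D) : 0 < (gdet L p).re := by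
  have h0 : 0 < (gm L 0 0 p).re := by
    have := hL.posdef p hp (Pi.single 0 1) (by simp)
    simpa [Fin.sum_univ_two] using this
  have him : (gm L 0 0 p).im = 0 := conj_eq_iff_im.1 (hL.hermitian p hp 0 0)
  have h1 := hL.posdef p hp ![-gm L 1 0 p, gm L 0 0 p] (by
    intro h
    have h2 := congrFun h 1
    simp at h2
    simp [h2] at h0)
  have e : (∑ i, ∑ j, gm L i j p * ![-gm L 1 0 p, gm L 0 0 p] i *
      (starRingEnd ℂ) (![-gm L 1 0 p, gm L 0 0 p] j)) = gdet L p * gm L 0 0 p := by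
    simp [Fin.sum_univ_two, hL.hermitian p hp, gdet]
    ring
  rw [e, mul_re, him, mul_zero, sub_zero] at h1
  exact pos_of_mul_pos_left h1 h0.le

theorem sg_sq (hL : IsCFM 2 D L) (hp : p ∈ D) : sg L p ^ 2 = gdet L p := by
  rw [sg, det_gmat, ← ofReal_pow, Real.sq_sqrt (hL.gdet_re_pos hp).le]
  exact conj_eq_iff_re.1 (hL.conj_gdet hp)

theorem Fh_sq (hL : IsCFM 2 D L) (hp : p ∈ D) : Fh L p ^ 2 = L p := by
  rw [Fh, ← ofReal_pow, Real.sq_sqrt (hL.pos p hp).le]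
  exact conj_eq_iff_re.1 (hL.conj_apply hp)

theorem gdet_ne (hL : IsCFM 2 D L) (hp : p ∈ D) : gdet L p ≠ 0 := by
  intro h
  simpa [h] using hL.gdet_re_pos hp

theorem sg_ne (hL : IsCFM 2 D L) (hp : p ∈ D) : sg L p ≠ 0 := by
  intro h
  simpa [h, hL.gdet_ne hp] using (hL.sg_sq hp).symm

theorem apply_ne (hL : IsCFM 2 D L) (hp : p ∈ D) : L p ≠ 0 := by
  intro h
  simpa [h] using hL.pos p hp

theorem Fh_ne (hL : IsCFM 2 D L) (hp : p ∈ D) : Fh L p ≠ 0 := by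
  intro h
  simpa [h, hL.apply_ne hp] using (hL.Fh_sq hp).symm

theorem contDiffOn_sqrt_re (hf : ContDiffOn ℝ (⊤ : ℕ∞) L D) (hpos : ∀ q ∈ D, 0 < (L q).re) :
    ContDiffOn ℝ (⊤ : ℕ∞) (fun q => (Real.sqrt (L q).re : ℂ)) D :=
  ofRealCLM.contDiff.comp_contDiffOn
    ((reCLM.contDiff.comp_contDiffOn hf).sqrt fun q hq => (hpos q hq).ne')

theorem contDiffOn_gdet (hL : IsCFM 2 D L) : ContDiffOn ℝ (⊤ : ℕ∞) (gdet L) D :=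
  ((hL.contDiffOn_gm 0 0).mul (hL.contDiffOn_gm 1 1)).sub
    ((hL.contDiffOn_gm 0 1).mul (hL.contDiffOn_gm 1 0))

theorem contDiffOn_Fh (hL : IsCFM 2 D L) : ContDiffOn ℝ (⊤ : ℕ∞) (Fh L) D :=
  contDiffOn_sqrt_re hL.smooth hL.pos

theorem contDiffOn_sg (hL : IsCFM 2 D L) : ContDiffOn ℝ (⊤ : ℕ∞) (sg L) D := by
  have : sg L = fun q => (Real.sqrt (gdet L q).re : ℂ) := by
    funext q; rw [sg, det_gmat]
  rw [this]
  exact contDiffOn_sqrt_re hL.contDiffOn_gdet fun q hq => hL.gdet_re_pos hq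

theorem der_Fh (hL : IsCFM 2 D L) {X : (Pt 2 → ℂ) → ℂ} (hX : IsDer D p X) :
    2 * Fh L p * X (Fh L) = X L := by
  rw [← hX.congr (fun q => Fh L q * Fh L q) L fun q hq => by rw [← hL.Fh_sq hq]; ring,
    hX.mul _ _ hL.contDiffOn_Fh hL.contDiffOn_Fh]
  ring

theorem der_sg (hL : IsCFM 2 D L) {X : (Pt 2 → ℂ) → ℂ} (hX : IsDer D p X) :
    2 * sg L p * X (sg L) = X (gdet L) := by
  rw [← hX.congr (fun q => sg L q * sg L q) (gdet L) fun q hq => by rw [← hL.sg_sq hq]; ring,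
    hX.mul _ _ hL.contDiffOn_sg hL.contDiffOn_sg]
  ring

theorem der_gdet (hL : IsCFM 2 D L) {X : (Pt 2 → ℂ) → ℂ} (hX : IsDer D p X) :
    X (gdet L) = X (gm L 0 0) * gm L 1 1 p + gm L 0 0 p * X (gm L 1 1) -
      (X (gm L 0 1) * gm L 1 0 p + gm L 0 1 p * X (gm L 1 0)) := by
  have : gdet L = fun q => (fun q => gm L 0 0 q * gm L 1 1 q) q -
    (fun q => gm L 0 1 q * gm L 1 0 q) q := rfl
  rw [this, hX.sub ((hL.contDiffOn_gm 0 0).mul (hL.contDiffOn_gm 1 1))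
    ((hL.contDiffOn_gm 0 1).mul (hL.contDiffOn_gm 1 0)),
    hX.mul _ _ (hL.contDiffOn_gm 0 0) (hL.contDiffOn_gm 1 1),
    hX.mul _ _ (hL.contDiffOn_gm 0 1) (hL.contDiffOn_gm 1 0)]

theorem gi_mul_gm (hL : IsCFM 2 D L) (hp : p ∈ D) (m j : Fin 2) :
    gi L m 0 p * gm L 0 j p + gi L m 1 p * gm L 1 j p = if m = j then 1 else 0 := by
  have h := Matrix.nonsing_inv_mul (gmat L p)
    (isUnit_iff_ne_zero.2 (by rw [det_gmat]; exact hL.gdet_ne hp))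
  have h' := congrFun (congrFun h m) j
  rw [Matrix.mul_apply, Fin.sum_univ_two, Matrix.one_apply] at h'
  exact h'

theorem gi_eq (L : Pt 2 → ℂ) (p : Pt 2) :
    gi L 0 0 p = gm L 1 1 p / gdet L p ∧ gi L 0 1 p = -gm L 0 1 p / gdet L p ∧
      gi L 1 0 p = -gm L 1 0 p / gdet L p ∧ gi L 1 1 p = gm L 0 0 p / gdet L p := by
  simp only [gi, Matrix.inv_def, Ring.inverse_eq_inv', det_gmat, Matrix.adjugate_fin_two]
  simp [gmat, div_eq_inv_mul]

theorem contDiffOn_gi (hL : IsCFM 2 D L) (l i : Fin 2) :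
    ContDiffOn ℝ (⊤ : ℕ∞) (gi L l i) D := by
  have h := fun (f : Pt 2 → ℂ) (hf : ContDiffOn ℝ (⊤ : ℕ∞) f D) =>
    hf.mul (hL.contDiffOn_gdet.inv fun q hq => hL.gdet_ne hq)
  fin_cases l <;> fin_cases i
  · exact (h _ (hL.contDiffOn_gm 1 1)).congr fun q _ => (gi_eq L q).1
  · exact (h _ (hL.contDiffOn_gm 0 1).neg).congr fun q _ => (gi_eq L q).2.1
  · exact (h _ (hL.contDiffOn_gm 1 0).neg).congr fun q _ => (gi_eq L q).2.2.1
  · exact (h _ (hL.contDiffOn_gm 0 0)).congr fun q _ => (gi_eq L q).2.2.2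

theorem Nc_eq (hL : IsCFM 2 D L) (hp : p ∈ D) (i k : Fin 2) :
    Nc L i k p = gi L 0 i p * dz (debar L 0) k p + gi L 1 i p * dz (debar L 1) k p := by
  have h : ∀ m, dz (gm L 0 m) k p * eta 0 p + dz (gm L 1 m) k p * eta 1 p =
      dz (debar L m) k p := by
    intro m
    have hX := isDer_dz hL.openD hp k
    have e := hX.congr _ _ fun q hq => hL.gm_eta hq m
    rw [hX.add_mul (hL.contDiffOn_gm 0 m) (contDiffOn_eta D 0)
      (hL.contDiffOn_gm 1 m) (contDiffOn_eta D 1)] at e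
    simp only [dz_eta, mul_zero, add_zero] at e
    exact e
  simp only [Nc, Fin.sum_univ_two, ← h, eta]
  ring

theorem contDiffOn_Nc (hL : IsCFM 2 D L) (i k : Fin 2) :
    ContDiffOn ℝ (⊤ : ℕ∞) (Nc L i k) D :=
  (((hL.contDiffOn_gi 0 i).mul (contDiffOn_dz hL.openD (hL.contDiffOn_debar 0) k)).add
    ((hL.contDiffOn_gi 1 i).mul (contDiffOn_dz hL.openD (hL.contDiffOn_debar 1) k))).congr
    fun _ hq => hL.Nc_eq hq i k

theorem Gs_eq (L : Pt 2 → ℂ) (p : Pt 2) (i : Fin 2) :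
    Gs L i p = (1 / 2) * (Nc L i 0 p * eta 0 p + Nc L i 1 p * eta 1 p) := by
  simp only [Gs, Fin.sum_univ_two, eta]

theorem contDiffOn_Gs (hL : IsCFM 2 D L) (i : Fin 2) : ContDiffOn ℝ (⊤ : ℕ∞) (Gs L i) D :=
  (contDiffOn_const.mul (((hL.contDiffOn_Nc i 0).mul (contDiffOn_eta D 0)).add
    ((hL.contDiffOn_Nc i 1).mul (contDiffOn_eta D 1)))).congr fun q _ => Gs_eq L q i

theorem Nc_mul_gm (hL : IsCFM 2 D L) (hp : p ∈ D) (j k : Fin 2) :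
    Nc L 0 k p * gm L 0 j p + Nc L 1 k p * gm L 1 j p = dz (debar L j) k p := by
  have h0 := hL.gi_mul_gm hp 0 j
  have h1 := hL.gi_mul_gm hp 1 j
  rw [hL.Nc_eq hp, hL.Nc_eq hp]
  fin_cases j <;> simp at h0 h1 ⊢ <;>
    linear_combination dz (debar L 0) k p * h0 + dz (debar L 1) k p * h1

theorem Gs_mul_gm (hL : IsCFM 2 D L) (hp : p ∈ D) (j : Fin 2) :
    Gs L 0 p * gm L 0 j p + Gs L 1 p * gm L 1 j p =
      (1 / 2) * (eta 0 p * dz (debar L j) 0 p + eta 1 p * dz (debar L j) 1 p) := by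
  rw [Gs_eq, Gs_eq, ← hL.Nc_mul_gm hp, ← hL.Nc_mul_gm hp]
  ring

theorem isDer_del (hL : IsCFM 2 D L) (hp : p ∈ D) (k : Fin 2) :
    IsDer D p (fun f => del L f k p) := by
  have h := ((isDer_dz hL.openD hp k).linear_comb ((isDer_de hL.openD hp 0).linear_comb
    (isDer_de hL.openD hp 1) (Nc L 0 k p) (Nc L 1 k p)) 1 (-1))
  have e : (fun f => del L f k p) = fun f => 1 * dz f k p +
      -1 * (Nc L 0 k p * de f 0 p + Nc L 1 k p * de f 1 p) := by
    funext f; simp only [del, Fin.sum_univ_two]; ring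
  rw [e]
  exact h

theorem del_debar (hL : IsCFM 2 D L) (hp : p ∈ D) (j k : Fin 2) :
    del L (debar L j) k p = 0 := by
  rw [del, Fin.sum_univ_two, ← hL.Nc_mul_gm hp, gm, gm, sub_self]

theorem del_etab (L : Pt 2 → ℂ) (p : Pt 2) (j k : Fin 2) : del L (etab j) k p = 0 := by
  simp [del, dz_etab, de_etab]

theorem del_eta (L : Pt 2 → ℂ) (p : Pt 2) (j k : Fin 2) : del L (eta j) k p = -Nc L j k p := by
  fin_cases j <;> simp [del, dz_eta, de_eta]

theorem del_apply (hL : IsCFM 2 D L) (hp : p ∈ D) (k : Fin 2) : del L L k p = 0 := by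
  have hX := hL.isDer_del hp k
  have e := hX.congr _ _ fun q hq => hL.euler_debar hq
  rw [hX.add_mul (hL.contDiffOn_debar 0) (contDiffOn_etab D 0) (hL.contDiffOn_debar 1)
    (contDiffOn_etab D 1)] at e
  simp only [del_etab, hL.del_debar hp, mul_zero, zero_mul, add_zero] at e
  exact e.symm

theorem Lc_mul_eta (hL : IsCFM 2 D L) (hp : p ∈ D) (i k : Fin 2) :
    Lc L i 0 k p * eta 0 p + Lc L i 1 k p * eta 1 p = Nc L i k p := by
  have h : ∀ l, del L (gm L 0 l) k p * eta 0 p + del L (gm L 1 l) k p * eta 1 p =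
      dz (debar L l) k p := by
    intro l
    have hX := hL.isDer_del hp k
    have e := hX.congr _ _ fun q hq => hL.gm_eta hq l
    rw [hX.add_mul (hL.contDiffOn_gm 0 l) (contDiffOn_eta D 0) (hL.contDiffOn_gm 1 l)
      (contDiffOn_eta D 1)] at e
    have e' := hL.del_debar hp l k
    simp only [del_eta] at e
    linear_combination e + e' + hL.Nc_mul_gm hp l k
  rw [hL.Nc_eq hp, ← h, ← h]
  simp only [Lc, Fin.sum_univ_two]
  ring

/-- The horizontal derivation along the spray, `η^k δ_k`. -/
def sprayDer (L : Pt 2 → ℂ) (p : Pt 2) (f : Pt 2 → ℂ) : ℂ :=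
  eta 0 p * del L f 0 p + eta 1 p * del L f 1 p

theorem isDer_sprayDer (hL : IsCFM 2 D L) (hp : p ∈ D) : IsDer D p (sprayDer L p) :=
  (hL.isDer_del hp 0).linear_comb (hL.isDer_del hp 1) _ _

theorem sprayDer_debar (hL : IsCFM 2 D L) (hp : p ∈ D) (j : Fin 2) :
    sprayDer L p (debar L j) = 0 := by simp [sprayDer, hL.del_debar hp]

theorem sprayDer_apply (hL : IsCFM 2 D L) (hp : p ∈ D) : sprayDer L p L = 0 := by
  simp [sprayDer, hL.del_apply hp]

theorem sprayDer_etab (L : Pt 2 → ℂ) (p : Pt 2) (j : Fin 2) : sprayDer L p (etab j) = 0 := by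
  simp [sprayDer, del_etab]

theorem sprayDer_debar_debar_symm (hL : IsCFM 2 D L) (hp : p ∈ D) (j h : Fin 2) :
    sprayDer L p (debar (debar L j) h) = sprayDer L p (debar (debar L h) j) :=
  (hL.isDer_sprayDer hp).congr _ _ fun _ hq => hL.debar_debar_symm hq j h

theorem sprayDer_debar_debar_etab (hL : IsCFM 2 D L) (hp : p ∈ D) (h : Fin 2) :
    sprayDer L p (debar (debar L 0) h) * etab 0 p +
      sprayDer L p (debar (debar L 1) h) * etab 1 p = 0 := by
  have hX := hL.isDer_sprayDer hp
  have e := hX.congr _ _ fun q hq => hL.debar_debar_etab hq h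
  rw [hX.add_mul (hL.contDiffOn_debar_debar 0 h) (contDiffOn_etab D 0)
    (hL.contDiffOn_debar_debar 1 h) (contDiffOn_etab D 1), hX.const] at e
  simpa only [sprayDer_etab, mul_zero, add_zero] using e

theorem debar_Gs_mul_gm (hL : IsCFM 2 D L) (hp : p ∈ D) (j h : Fin 2) :
    2 * (debar (Gs L 0) h p * gm L 0 j p + debar (Gs L 1) h p * gm L 1 j p) =
      sprayDer L p (debar (debar L j) h) := by
  have hX := isDer_debar hL.openD hp h
  have hdz := fun k => contDiffOn_dz hL.openD (hL.contDiffOn_debar j) k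
  have e := hX.congr _ _ fun q hq => hL.Gs_mul_gm hq j
  rw [hX.add_mul (hL.contDiffOn_Gs 0) (hL.contDiffOn_gm 0 j) (hL.contDiffOn_Gs 1)
    (hL.contDiffOn_gm 1 j), hX.mul_const _ (((contDiffOn_eta D 0).mul (hdz 0)).add
    ((contDiffOn_eta D 1).mul (hdz 1))), hX.add_mul (contDiffOn_eta D 0) (hdz 0)
    (contDiffOn_eta D 1) (hdz 1)] at e
  simp only [debar_eta, debar_dz_comm hL.openD hp (hL.contDiffOn_debar j),
    hL.debar_gm hp] at e
  simp only [sprayDer, del, Fin.sum_univ_two]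
  rw [Gs_eq, Gs_eq] at e
  linear_combination 2 * e

theorem conj_Fh (L : Pt 2 → ℂ) (p : Pt 2) : (starRingEnd ℂ) (Fh L p) = Fh L p := conj_ofReal _

theorem conj_sg (L : Pt 2 → ℂ) (p : Pt 2) : (starRingEnd ℂ) (sg L p) = sg L p := conj_ofReal _

theorem llow_eq (hL : IsCFM 2 D L) (hp : p ∈ D) (i : Fin 2) :
    llow L i p = de L i p / Fh L p := by
  rw [← hL.gm_etab hp, llow, Fin.sum_univ_two]; rfl

theorem mup_zero (hL : IsCFM 2 D L) (hp : p ∈ D) :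
    mup L 0 p = -de L 1 p / (Fh L p * sg L p) := by
  rw [mup, if_pos rfl, hL.llow_eq hp, ← neg_div, div_div]

theorem mup_one (hL : IsCFM 2 D L) (hp : p ∈ D) :
    mup L 1 p = de L 0 p / (Fh L p * sg L p) := by
  rw [mup, if_neg one_ne_zero, hL.llow_eq hp, div_div]

theorem conj_mup_zero (hL : IsCFM 2 D L) (hp : p ∈ D) :
    (starRingEnd ℂ) (mup L 0 p) = -debar L 1 p / (Fh L p * sg L p) := by
  rw [hL.mup_zero hp, map_div₀, map_neg, map_mul, conj_Fh, conj_sg, hL.conj_de hp]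

theorem conj_mup_one (hL : IsCFM 2 D L) (hp : p ∈ D) :
    (starRingEnd ℂ) (mup L 1 p) = debar L 0 p / (Fh L p * sg L p) := by
  rw [hL.mup_one hp, map_div₀, map_mul, conj_Fh, conj_sg, hL.conj_de hp]

theorem mlow_zero (hL : IsCFM 2 D L) (hp : p ∈ D) :
    mlow L 0 p = -(sg L p * eta 1 p) / Fh L p := by
  have hF := hL.Fh_ne hp
  have hs := hL.sg_ne hp
  rw [mlow, Fin.sum_univ_two, hL.conj_mup_zero hp, hL.conj_mup_one hp, ← hL.gm_eta hp,
    ← hL.gm_eta hp]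
  field_simp
  rw [hL.sg_sq hp, gdet]
  ring

theorem mlow_one (hL : IsCFM 2 D L) (hp : p ∈ D) :
    mlow L 1 p = sg L p * eta 0 p / Fh L p := by
  have hF := hL.Fh_ne hp
  have hs := hL.sg_ne hp
  rw [mlow, Fin.sum_univ_two, hL.conj_mup_zero hp, hL.conj_mup_one hp, ← hL.gm_eta hp,
    ← hL.gm_eta hp]
  field_simp
  rw [hL.sg_sq hp, gdet]
  ring

theorem sO_eq (hL : IsCFM 2 D L) (hp : p ∈ D) :
    sO L p = 2 * sg L p * (Gs L 1 p * eta 0 p - Gs L 0 p * eta 1 p) / Fh L p ^ 3 := by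
  have hF := hL.Fh_ne hp
  simp only [sO, Fin.sum_univ_two, hL.mlow_zero hp, hL.mlow_one hp, lup, Gs_eq,
    ← hL.Lc_mul_eta hp, eta]
  field_simp
  ring

theorem contDiffOn_sO (hL : IsCFM 2 D L) : ContDiffOn ℝ (⊤ : ℕ∞) (sO L) D :=
  (((contDiffOn_const.mul hL.contDiffOn_sg).mul
    (((hL.contDiffOn_Gs 1).mul (contDiffOn_eta D 0)).sub
      ((hL.contDiffOn_Gs 0).mul (contDiffOn_eta D 1)))).mul
    ((hL.contDiffOn_Fh.pow 3).inv fun _ hq => pow_ne_zero 3 (hL.Fh_ne hq))).congr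
    fun _ hq => hL.sO_eq hq

theorem gm_mul_Cc (hL : IsCFM 2 D L) (hp : p ∈ D) (w : Fin 2 → ℂ) (j k : Fin 2) :
    (gm L 0 0 p * w 0 + gm L 0 1 p * w 1) * Cc L 0 j k p +
      (gm L 1 0 p * w 0 + gm L 1 1 p * w 1) * Cc L 1 j k p =
      w 0 * de (gm L j 0) k p + w 1 * de (gm L j 1) k p := by
  have h00 := hL.gi_mul_gm hp 0 0
  have h01 := hL.gi_mul_gm hp 0 1
  have h10 := hL.gi_mul_gm hp 1 0
  have h11 := hL.gi_mul_gm hp 1 1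
  simp at h00 h01 h10 h11
  simp only [Cc, Fin.sum_univ_two]
  linear_combination de (gm L j 0) k p * (w 0 * h00 + w 1 * h01) +
    de (gm L j 1) k p * (w 0 * h10 + w 1 * h11)

theorem conj_de_gm (hL : IsCFM 2 D L) (hp : p ∈ D) (i j k : Fin 2) :
    (starRingEnd ℂ) (de (gm L i j) k p) = debar (gm L j i) k p := by
  rw [CFinsler.conj_de]
  exact (isDer_debar hL.openD hp k).congr _ _ fun q hq => hL.hermitian q hq i j

/-- The derivation `m̄^s ∂/∂η̄^s`. -/
def conjFrameDer (L : Pt 2 → ℂ) (p : Pt 2) (f : Pt 2 → ℂ) : ℂ :=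
  (starRingEnd ℂ) (mup L 0 p) * debar f 0 p + (starRingEnd ℂ) (mup L 1 p) * debar f 1 p

theorem isDer_conjFrameDer (hL : IsCFM 2 D L) (hp : p ∈ D) : IsDer D p (conjFrameDer L p) :=
  (isDer_debar hL.openD hp 0).linear_comb (isDer_debar hL.openD hp 1) _ _

theorem debar_gdet (hL : IsCFM 2 D L) (hp : p ∈ D) (h : Fin 2) :
    L p * debar (gdet L) h p = de L 1 p * debar L 1 p * debar (gm L 0 0) h p -
      de L 1 p * debar L 0 p * debar (gm L 0 1) h p -
      de L 0 p * debar L 1 p * debar (gm L 1 0) h p +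
      de L 0 p * debar L 0 p * debar (gm L 1 1) h p := by
  have e0 := hL.debar_gm_etab hp 0 h
  have e1 := hL.debar_gm_etab hp 1 h
  rw [hL.der_gdet (isDer_debar hL.openD hp h), ← hL.euler_de hp, ← hL.gm_etab hp,
    ← hL.gm_etab hp, ← hL.gm_eta hp, ← hL.gm_eta hp]
  linear_combination (gm L 0 0 p * gm L 1 1 p - gm L 0 1 p * gm L 1 0 p) *
    (eta 0 p * e0 + eta 1 p * e1)

theorem conj_sB (hL : IsCFM 2 D L) (hp : p ∈ D) :
    gdet L p * (starRingEnd ℂ) (sB L p) = conjFrameDer L p (gdet L) := by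
  have hF := hL.Fh_ne hp
  have hs := hL.sg_ne hp
  have hB : sB L p = ∑ j, ∑ k, mup L k p * mup L j p *
      ((starRingEnd ℂ) (mup L 0 p) * de (gm L j 0) k p +
        (starRingEnd ℂ) (mup L 1 p) * de (gm L j 1) k p) := by
    simp only [← hL.gm_mul_Cc hp (fun i => (starRingEnd ℂ) (mup L i p))]
    simp only [sB, mlow, Fin.sum_univ_two]
    ring
  have h0 := hL.debar_gdet hp 0
  have h1 := hL.debar_gdet hp 1
  rw [hB]
  simp only [Fin.sum_univ_two, map_add, map_mul, conj_conj, hL.conj_de_gm hp, conjFrameDer]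
  rw [hL.conj_mup_zero hp, hL.conj_mup_one hp, hL.mup_zero hp, hL.mup_one hp, ← hL.sg_sq hp]
  rw [← hL.Fh_sq hp] at h0 h1
  field_simp
  linear_combination debar L 1 p * h0 - debar L 0 p * h1

theorem conj_sA (hL : IsCFM 2 D L) (hp : p ∈ D) :
    L p * (Fh L p * (gdet L p * (starRingEnd ℂ) (sA L p))) =
      debar L 1 p * debar L 1 p * debar (debar L 0) 0 p -
      debar L 0 p * debar L 1 p * (debar (debar L 0) 1 p + debar (debar L 1) 0 p) +
      debar L 0 p * debar L 0 p * debar (debar L 1) 1 p := by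
  have hF := hL.Fh_ne hp
  have hs := hL.sg_ne hp
  have hA : sA L p = ∑ j, ∑ k, mup L j p * mup L k p *
      (etab 0 p * de (gm L k 0) j p + etab 1 p * de (gm L k 1) j p) / Fh L p := by
    simp only [← hL.gm_mul_Cc hp (fun i => etab i p)]
    simp only [sA, llow, Fin.sum_univ_two, etab]
    ring
  have h := hL.debar_gm_eta hp
  simp only [eta] at h
  rw [hA]
  simp only [Fin.sum_univ_two, map_add, map_mul, map_div₀, conj_conj, hL.conj_de_gm hp, etab,
    conj_Fh, mul_comm (p.2 _), h]
  rw [hL.conj_mup_zero hp, hL.conj_mup_one hp, ← hL.sg_sq hp, ← hL.Fh_sq hp]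
  field_simp
  ring

theorem sJ_add_sY (hL : IsCFM 2 D L) (hp : p ∈ D) :
    Fh L p * gdet L p * (sJ L p + sY L p) = sprayDer L p (gdet L) := by
  have hF := hL.Fh_ne hp
  have hs := hL.sg_ne hp
  have hd := hL.gdet_ne hp
  have hc : ∀ k, gdet L p * (Lc L 0 0 k p + Lc L 1 1 k p) = del L (gdet L) k p := by
    intro k
    obtain ⟨h00, h01, h10, h11⟩ := gi_eq L p
    rw [hL.der_gdet (hL.isDer_del hp k)]
    simp only [Lc, Fin.sum_univ_two, h00, h01, h10, h11]
    field_simp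
    ring
  have he := hL.euler_de hp
  rw [← hL.Fh_sq hp] at he
  have ht : Fh L p * (sJ L p + sY L p) =
      eta 0 p * (Lc L 0 0 0 p + Lc L 1 1 0 p) + eta 1 p * (Lc L 0 0 1 p + Lc L 1 1 1 p) := by
    simp only [sJ, sY, Fin.sum_univ_two, hL.mlow_zero hp, hL.mlow_one hp, lup, hL.llow_eq hp,
      hL.mup_zero hp, hL.mup_one hp]
    simp only [eta] at he ⊢
    field_simp
    linear_combination (p.2 0 * (Lc L 0 0 0 p + Lc L 1 1 0 p) +
      p.2 1 * (Lc L 0 0 1 p + Lc L 1 1 1 p)) * he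
  rw [sprayDer, ← hc, ← hc]
  linear_combination gdet L p * ht

/-- The contraction of `η^k δ_k (∂²L/∂η̄^j∂η̄^h)` with `(-L_{2̄}, L_{1̄})` in both indices. -/
def sprayDefect (L : Pt 2 → ℂ) (p : Pt 2) : ℂ :=
  debar L 1 p * debar L 1 p * sprayDer L p (debar (debar L 0) 0) -
    debar L 0 p * debar L 1 p *
      (sprayDer L p (debar (debar L 0) 1) + sprayDer L p (debar (debar L 1) 0)) +
    debar L 0 p * debar L 0 p * sprayDer L p (debar (debar L 1) 1)

theorem debar_Gs_eq_zero_iff (hL : IsCFM 2 D L) (hp : p ∈ D) :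
    (∀ i h : Fin 2, debar (Gs L i) h p = 0) ↔ sprayDefect L p = 0 := by
  constructor
  · intro H
    have hR : ∀ j h, sprayDer L p (debar (debar L j) h) = 0 := by
      intro j h
      rw [← hL.debar_Gs_mul_gm hp, H, H]
      ring
    simp [sprayDefect, hR]
  · intro H
    have e0 := hL.sprayDer_debar_debar_etab hp 0
    have e1 := hL.sprayDer_debar_debar_etab hp 1
    have hs := hL.sprayDer_debar_debar_symm hp 1 0
    have hE := hL.euler_debar hp
    have hL2 : L p ^ 2 ≠ 0 := pow_ne_zero 2 (hL.apply_ne hp)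
    rw [hs] at e0
    rw [sprayDefect, hs] at H
    have hR : ∀ j h, sprayDer L p (debar (debar L j) h) = 0 := by
      have h00 : sprayDer L p (debar (debar L 0) 0) = 0 := by
        refine (mul_eq_zero.1 ?_).resolve_left hL2
        rw [← hE]
        linear_combination etab 1 p ^ 2 * H + (debar L 0 p ^ 2 * etab 0 p +
          2 * debar L 0 p * debar L 1 p * etab 1 p) * e0 - debar L 0 p ^ 2 * etab 1 p * e1
      have h01 : sprayDer L p (debar (debar L 0) 1) = 0 := by
        refine (mul_eq_zero.1 ?_).resolve_left hL2
        rw [← hE]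
        linear_combination -(etab 0 p * etab 1 p) * H + debar L 1 p ^ 2 * etab 1 p * e0 +
          debar L 0 p ^ 2 * etab 0 p * e1
      have h11 : sprayDer L p (debar (debar L 1) 1) = 0 := by
        refine (mul_eq_zero.1 ?_).resolve_left hL2
        rw [← hE]
        linear_combination etab 0 p ^ 2 * H + (debar L 1 p ^ 2 * etab 1 p +
          2 * debar L 0 p * debar L 1 p * etab 0 p) * e1 - debar L 1 p ^ 2 * etab 0 p * e0
      intro j h
      fin_cases j <;> fin_cases h
      exacts [h00, h01, hs.trans h01, h11]
    intro i h
    have g0 := (hL.debar_Gs_mul_gm hp 0 h).trans (hR 0 h)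
    have g1 := (hL.debar_Gs_mul_gm hp 1 h).trans (hR 1 h)
    refine (mul_eq_zero.1 ?_).resolve_left (hL.gdet_ne hp)
    fin_cases i
    · simp only [gdet, Fin.zero_eta]
      linear_combination (gm L 1 1 p * g0 - gm L 1 0 p * g1) / 2
    · simp only [gdet, Fin.mk_one]
      linear_combination (gm L 0 0 p * g1 - gm L 0 1 p * g0) / 2

theorem conjFrameDer_sO (hL : IsCFM 2 D L) (hp : p ∈ D) :
    L p * L p * gdet L p * (conjFrameDer L p (sO L) -
      (1 / 2) * (starRingEnd ℂ) (sB L p) * sO L p) = sprayDefect L p := by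
  have hF := hL.Fh_ne hp
  have hs := hL.sg_ne hp
  have hX := hL.isDer_conjFrameDer hp
  have hXL : conjFrameDer L p L = 0 := by
    rw [conjFrameDer, hL.conj_mup_zero hp, hL.conj_mup_one hp]
    ring
  have hXF : conjFrameDer L p (Fh L) = 0 := by
    have h := hL.der_Fh hX
    rw [hXL] at h
    simpa [hF] using h
  have hXs : 2 * conjFrameDer L p (sg L) = sg L p * (starRingEnd ℂ) (sB L p) := by
    have h := hL.der_sg hX
    rw [← hL.conj_sB hp, ← hL.sg_sq hp] at h
    refine mul_left_cancel₀ hs ?_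
    linear_combination h
  have hXη : ∀ j, conjFrameDer L p (eta j) = 0 := by
    intro j
    simp [conjFrameDer, debar_eta]
  have sG := (hL.contDiffOn_Gs 1).mul (contDiffOn_eta D 0)
  have sG' := (hL.contDiffOn_Gs 0).mul (contDiffOn_eta D 1)
  have e := hX.congr (fun q => Fh L q * (L q * sO L q))
    (fun q => (2 * sg L q) * (Gs L 1 q * eta 0 q - Gs L 0 q * eta 1 q)) (by
      intro q hq
      have := hL.Fh_ne hq
      rw [hL.sO_eq hq, ← hL.Fh_sq hq]
      field_simp)
  rw [hX.mul _ _ hL.contDiffOn_Fh (hL.smooth.mul hL.contDiffOn_sO),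
    hX.mul _ _ hL.smooth hL.contDiffOn_sO,
    hX.mul (fun q => 2 * sg L q) (fun q => Gs L 1 q * eta 0 q - Gs L 0 q * eta 1 q)
      (contDiffOn_const.mul hL.contDiffOn_sg) (sG.sub sG'),
    hX.mul_const 2 hL.contDiffOn_sg, hX.sub sG sG',
    hX.mul _ _ (hL.contDiffOn_Gs 1) (contDiffOn_eta D 0),
    hX.mul _ _ (hL.contDiffOn_Gs 0) (contDiffOn_eta D 1), hXL, hXF, hXs, hXη, hXη] at e
  have hO := hL.sO_eq hp
  rw [eq_div_iff (pow_ne_zero 3 hF)] at hO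
  have hT : sprayDefect L p = 2 * gdet L p * (Fh L p * sg L p) *
      (eta 0 p * conjFrameDer L p (Gs L 1) - eta 1 p * conjFrameDer L p (Gs L 0)) := by
    simp only [sprayDefect, ← hL.debar_Gs_mul_gm hp, conjFrameDer, hL.conj_mup_zero hp,
      hL.conj_mup_one hp]
    field_simp
    simp only [← hL.gm_eta hp, gdet]
    ring
  rw [hT]
  rw [← hL.Fh_sq hp] at e ⊢
  linear_combination gdet L p * Fh L p * e -
    (1 / 2) * Fh L p * gdet L p * (starRingEnd ℂ) (sB L p) * hO

theorem sprayDer_conj_sA (hL : IsCFM 2 D L) (hp : p ∈ D) :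
    L p * Fh L p * gdet L p * (sprayDer L p (fun q => (starRingEnd ℂ) (sA L q)) +
      Fh L p * (starRingEnd ℂ) (sA L p) * (sJ L p + sY L p)) = sprayDefect L p := by
  have hF := hL.Fh_ne hp
  have hX := hL.isDer_sprayDer hp
  have hXF : sprayDer L p (Fh L) = 0 := by
    have h := hL.der_Fh hX
    rw [hL.sprayDer_apply hp] at h
    simpa [hF] using h
  have hX0 : ∀ f g : Pt 2 → ℂ, sprayDer L p f = 0 → ContDiffOn ℝ (⊤ : ℕ∞) f D →
      ContDiffOn ℝ (⊤ : ℕ∞) g D → sprayDer L p (fun q => f q * g q) = f p * sprayDer L p g := by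
    intro f g h hf hg
    rw [hX.mul f g hf hg, h, zero_mul, zero_add]
  have sb := hL.contDiffOn_debar
  have sQ := hL.contDiffOn_debar_debar
  have hb := hL.sprayDer_debar hp
  have s1 := (sb 1).mul ((sb 1).mul (sQ 0 0))
  have s2 := (sb 0).mul ((sb 1).mul ((sQ 0 1).add (sQ 1 0)))
  have s3 := (sb 0).mul ((sb 0).mul (sQ 1 1))
  have hA : ∀ q ∈ D, L q * (Fh L q * (gdet L q * (starRingEnd ℂ) (sA L q))) =
      debar L 1 q * (debar L 1 q * debar (debar L 0) 0 q) -
      debar L 0 q * (debar L 1 q * (debar (debar L 0) 1 q + debar (debar L 1) 0 q)) +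
      debar L 0 q * (debar L 0 q * debar (debar L 1) 1 q) := by
    intro q hq
    rw [hL.conj_sA hq]
    ring
  have hAs : ContDiffOn ℝ (⊤ : ℕ∞) (fun q => (starRingEnd ℂ) (sA L q)) D := by
    refine (((s1.sub s2).add s3).mul ((hL.smooth.mul (hL.contDiffOn_Fh.mul
      hL.contDiffOn_gdet)).inv fun q hq => mul_ne_zero (hL.apply_ne hq)
        (mul_ne_zero (hL.Fh_ne hq) (hL.gdet_ne hq)))).congr fun q hq => ?_
    refine (eq_mul_inv_iff_mul_eq₀ (mul_ne_zero (hL.apply_ne hq)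
      (mul_ne_zero (hL.Fh_ne hq) (hL.gdet_ne hq)))).2 ?_
    rw [← hA q hq]
    ring
  have e := hX.congr _ _ hA
  rw [hX0 L _ (hL.sprayDer_apply hp) hL.smooth (hL.contDiffOn_Fh.mul (hL.contDiffOn_gdet.mul hAs)),
    hX0 (Fh L) _ hXF hL.contDiffOn_Fh (hL.contDiffOn_gdet.mul hAs),
    hX.mul (gdet L) _ hL.contDiffOn_gdet hAs, hX.add _ _ (s1.sub s2) s3, hX.sub s1 s2,
    hX0 _ _ (hb 1) (sb 1) ((sb 1).mul (sQ 0 0)), hX0 _ _ (hb 1) (sb 1) (sQ 0 0),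
    hX0 _ _ (hb 0) (sb 0) ((sb 1).mul ((sQ 0 1).add (sQ 1 0))),
    hX0 _ _ (hb 1) (sb 1) ((sQ 0 1).add (sQ 1 0)), hX.add _ _ (sQ 0 1) (sQ 1 0),
    hX0 _ _ (hb 0) (sb 0) ((sb 0).mul (sQ 1 1)), hX0 _ _ (hb 0) (sb 0) (sQ 1 1)] at e
  rw [sprayDefect]
  linear_combination e + L p * Fh L p * (starRingEnd ℂ) (sA L p) * hL.sJ_add_sY hp

end IsCFM

end metric

/-- equivalence of `∂G^i/∂η̄^h = 0`, `m̄^s ∂O/∂η̄^s = ½ B̄ O`, and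
`δ_k(Ā) η^k + F Ā (J+Y) = 0`. -/
theorem statement5 (D : Set (Pt 2)) (L : Pt 2 → ℂ) (hL : IsCFM 2 D L) :
    ((∀ p ∈ D, ∀ i h : Fin 2, debar (Gs L i) h p = 0) ↔
      (∀ p ∈ D, (∑ s, (starRingEnd ℂ) (mup L s p) * debar (sO L) s p) =
        (1 / 2) * (starRingEnd ℂ) (sB L p) * sO L p)) ∧
    ((∀ p ∈ D, (∑ s, (starRingEnd ℂ) (mup L s p) * debar (sO L) s p) =
        (1 / 2) * (starRingEnd ℂ) (sB L p) * sO L p) ↔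
      (∀ p ∈ D, (∑ k, del L (fun q => (starRingEnd ℂ) (sA L q)) k p * p.2 k) +
        Fh L p * (starRingEnd ℂ) (sA L p) * (sJ L p + sY L p) = 0)) := by
  have hb : ∀ p ∈ D, (∑ s, (starRingEnd ℂ) (mup L s p) * debar (sO L) s p) =
      (1 / 2) * (starRingEnd ℂ) (sB L p) * sO L p ↔ IsCFM.sprayDefect L p = 0 := by
    intro p hp
    rw [← hL.conjFrameDer_sO hp, mul_eq_zero, or_iff_right (mul_ne_zero (mul_ne_zero
      (hL.apply_ne hp) (hL.apply_ne hp)) (hL.gdet_ne hp)), sub_eq_zero, Fin.sum_univ_two]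
    rfl
  have hc : ∀ p ∈ D, (∑ k, del L (fun q => (starRingEnd ℂ) (sA L q)) k p * p.2 k) +
      Fh L p * (starRingEnd ℂ) (sA L p) * (sJ L p + sY L p) = 0 ↔
        IsCFM.sprayDefect L p = 0 := by
    intro p hp
    rw [← hL.sprayDer_conj_sA hp, mul_eq_zero, or_iff_right (mul_ne_zero (mul_ne_zero
      (hL.apply_ne hp) (hL.Fh_ne hp)) (hL.gdet_ne hp)), Fin.sum_univ_two, IsCFM.sprayDer,
      eta, eta, mul_comm (p.2 0), mul_comm (p.2 1)]
  exact ⟨forall₂_congr fun p hp => (hL.debar_Gs_eq_zero_iff hp).trans (hb p hp).symm,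
    forall₂_congr fun p hp => (hb p hp).trans (hc p hp).symm⟩

end CFinsler
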